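/- If v ≡ 3 (mod 4) and v > 3, then every STS(v) admitting a zero-sum 3-flow can be embedded into an STS(2v+1) admitting a zero-sum 3-flow. -/

import Mathlib

theorem aux_d (m : ℕ) (hm : 2 ≤ m) :
    ∃ d : Fin m → ℤ, (∀ i, d i ≠ 0 ∧ |d i| ≤ 2) ∧ ∑ i, d i = 0 := by
  induction m using Nat.strong_induction_on with
  | _ m ih =>
    by_cases h2 : m = 2
    · subst h2
      exact ⟨![1, -1], by decide, by decide⟩
    by_cases h3 : m = 3
    · subst h3
      exact ⟨![2, -1, -1], by decide, by decide⟩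
    obtain ⟨n, rfl⟩ : ∃ n, m = n + 2 := ⟨m - 2, by omega⟩
    obtain ⟨d, hd, hs⟩ := ih n (by omega) (by omega)
    refine ⟨Fin.cons 1 (Fin.cons (-1) d), ?_, ?_⟩
    · intro i
      refine Fin.cases ?_ (fun i => ?_) i
      · simp
      · refine Fin.cases ?_ (fun i => ?_) i
        · simp
        · simpa using hd i
    · simp [Fin.sum_univ_succ, hs]

theorem aux_d' (T : Type) [Fintype T] (hm : 2 ≤ Fintype.card T) :
    ∃ d : T → ℤ, (∀ i, d i ≠ 0 ∧ |d i| ≤ 2) ∧ ∑ i, d i = 0 := by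
  obtain ⟨d, hd, hs⟩ := aux_d _ hm
  refine ⟨fun t => d (Fintype.equivFin T t), fun i => hd _, ?_⟩
  rw [← hs]
  exact Equiv.sum_comp (Fintype.equivFin T) d

theorem aux_q (r : ℕ) (hr : r % 2 = 1) :
    ∃ q : ZMod r → Option (ZMod r) → Option (ZMod r),
      (∀ j x, q j (q j x) = x) ∧ (∀ j x, q j x ≠ x) ∧ (∀ x y, x ≠ y → ∃ j, q j x = y) := by
  obtain ⟨h, hh⟩ : ∃ h : ZMod r, h + h = 1 := by
    refine ⟨((r + 1) / 2 : ℕ), ?_⟩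
    rw [← Nat.cast_add, show (r + 1) / 2 + (r + 1) / 2 = r + 1 by omega]
    simp
  have hd : ∀ x y : ZMod r, x + x = y → y * h = x := by
    intro x y e
    rw [← e]; linear_combination x * hh
  have hd2 : ∀ y : ZMod r, y * h + y * h = y := fun y => by linear_combination y * hh
  refine ⟨fun j x => match x with
    | none => some (j * h)
    | some x => if x + x = j then none else some (j - x), ?_, ?_, ?_⟩
  · rintro j (_ | x)
    · simp [hd2]
    · by_cases e : x + x = j
      · simp [e, hd _ _ e]
      · have : ¬ (j - x + (j - x) = j) := fun e' => e (by linear_combination -e')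
        simp [e, this]
  · rintro j (_ | x)
    · simp
    · by_cases e : x + x = j
      · simp [e]
      · have : ¬ (j - x = x) := fun e' => e (by linear_combination -e')
        simp [e, this]
  · rintro (_ | x) (_ | y) hxy
    · exact absurd rfl hxy
    · exact ⟨y + y, by simp [hd _ _ rfl]⟩
    · exact ⟨x + x, by simp⟩
    · refine ⟨x + y, ?_⟩
      have : ¬ (x + x = x + y) := fun e => hxy (by rw [add_left_cancel e])
      simp [this]

/-- existence of the weighted one-factorisation -/
theorem aux_fact (v : ℕ) (hv : v % 4 = 3) (hv3 : 3 < v) :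
    ∃ (p : Fin v → Fin (v+1) → Fin (v+1)) (w : Fin v → Fin (v+1) → ℤ),
      (∀ i x, p i (p i x) = x) ∧ (∀ i x, p i x ≠ x) ∧ (∀ x y, x ≠ y → ∃ i, p i x = y) ∧
      (∀ i x, w i (p i x) = w i x) ∧ (∀ i x, w i x ≠ 0 ∧ |w i x| ≤ 2) ∧
      (∀ x, ∑ i, w i x = 0) ∧ (∀ i, ∑ x, w i x = 0) := by
  obtain ⟨k, hk2, rfl⟩ : ∃ k, 2 ≤ k ∧ v = 4 * k - 1 := ⟨(v + 1) / 4, by omega, by omega⟩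
  have : NeZero k := ⟨by omega⟩
  have : NeZero (2 * k - 1) := ⟨by omega⟩
  obtain ⟨q0, q01, q02, q03⟩ := aux_q (2 * k - 1) (by omega)
  let G := ZMod 2 × ZMod k
  let J := ZMod (2 * k - 1)
  let E : G ≃ Option J := Fintype.equivOfCardEq (by simp [G, J, ZMod.card]; omega)
  obtain ⟨d, hd, hds⟩ := aux_d' J (by simp [J, ZMod.card]; omega)
  obtain ⟨c, hc, hcs⟩ := aux_d' (ZMod k) (by simp [ZMod.card]; omega)
  let eps : ZMod 2 → ℤ := fun a => if a = 0 then 1 else -1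
  have heps : ∀ a b, eps (a - b) = eps a * eps b := by decide
  have heps0 : eps 0 + eps 1 = 0 := by decide
  have hepsv : ∀ a, eps a = 1 ∨ eps a = -1 := by decide
  let C := J ⊕ G
  let N := Bool × G
  let p : C → N → N := fun i x => match i with
    | .inl j => (x.1, E.symm (q0 j (E x.2)))
    | .inr i => (!x.1, i - x.2)
  let w : C → N → ℤ := fun i x => match i with
    | .inl j => if x.1 then d j else - d j
    | .inr i => if x.1 then c i.2 * eps x.2.1 else c i.2 * eps (i.1 - x.2.1)
  let eC : Fin (4 * k - 1) ≃ C := Fintype.equivOfCardEq (by simp [C, G, J, ZMod.card]; omega)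
  let eN : Fin (4 * k - 1 + 1) ≃ N := Fintype.equivOfCardEq (by simp [N, G, ZMod.card]; omega)
  have hS : ∀ y : ZMod 2 → ℤ, ∑ a, y a = y 0 + y 1 := fun y => Fin.sum_univ_two y
  have hE : ∀ i : ZMod 2, ∑ a, eps (i - a) = 0 := by decide
  have hp1 : ∀ i x, p i (p i x) = x := by
    rintro (j | i) ⟨b, x⟩
    · simp [p, q01]
    · simp [p]
  have hp2 : ∀ i x, p i x ≠ x := by
    rintro (j | i) ⟨b, x⟩
    · intro h
      replace h : E.symm (q0 j (E x)) = x := congrArg Prod.snd h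
      rw [Equiv.symm_apply_eq] at h
      exact q02 _ _ h
    · intro h
      replace h : (!b) = b := congrArg Prod.fst h
      simp at h
  have hp3 : ∀ x y, x ≠ y → ∃ i, p i x = y := by
    rintro ⟨b, x⟩ ⟨b', y⟩ h
    by_cases hb : b = b'
    · subst hb
      obtain ⟨j, hj⟩ := q03 (E x) (E y) (fun e => h (by rw [E.injective e]))
      exact ⟨.inl j, by simp [p, hj]⟩
    · refine ⟨.inr (x + y), ?_⟩
      simp only [p, add_sub_cancel_left]
      cases b <;> cases b' <;> simp_all
  have hw1 : ∀ i x, w i (p i x) = w i x := by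
    rintro (j | i) ⟨b, x⟩
    · simp [w, p]
    · have hx : i.1 - (i - x).1 = x.1 := sub_sub_cancel i.1 x.1
      cases b
      · rfl
      · simp [w, p, hx]
  have hw2 : ∀ i x, w i x ≠ 0 ∧ |w i x| ≤ 2 := by
    rintro (j | i) ⟨b, x⟩
    · cases b <;> simpa [w] using hd j
    · cases b
      · rcases hepsv (i.1 - x.1) with h | h <;> simpa [w, h] using hc i.2
      · rcases hepsv (x.1) with h | h <;> simpa [w, h] using hc i.2
  have hw3 : ∀ x, ∑ i, w i x = 0 := by
    rintro ⟨b, x⟩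
    cases b
    · simp only [C, Fintype.sum_sum_type, w, G, Fintype.sum_prod_type]
      simp only [Bool.false_eq_true, if_false, ← Finset.sum_mul, Finset.sum_neg_distrib, hds, hcs]
      simp
    · simp only [C, Fintype.sum_sum_type, w, G, Fintype.sum_prod_type]
      simp only [if_true, ← Finset.sum_mul, hds, hcs]
      simp
  have hw4 : ∀ i, ∑ x, w i x = 0 := by
    have h1 : ∑ a, eps a = 0 := by decide
    rintro (j | i)
    · simp only [N, w, Fintype.sum_prod_type, Fintype.sum_bool]
      simp
    · simp only [N, G, w, Fintype.sum_prod_type, Fintype.sum_bool]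
      simp only [Bool.false_eq_true, if_false, if_true, Finset.sum_const, ← Finset.smul_sum,
        ← Finset.mul_sum, h1, hE]
      simp
  refine ⟨fun i x => eN.symm (p (eC i) (eN x)), fun i x => w (eC i) (eN x), ?_, ?_, ?_, ?_, ?_,
    ?_, ?_⟩
  · intro i x; simp [hp1]
  · intro i x h
    rw [Equiv.symm_apply_eq] at h
    exact hp2 _ _ h
  · intro x y h
    obtain ⟨i, hi⟩ := hp3 (eN x) (eN y) (fun e => h (eN.injective e))
    exact ⟨eC.symm i, by simp [hi]⟩
  · intro i x; simp [hw1]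
  · intro i x; exact hw2 _ _
  · intro x
    exact (Equiv.sum_comp eC (fun i => w i (eN x))).trans (hw3 _)
  · intro i
    exact (Equiv.sum_comp eN (fun x => w (eC i) x)).trans (hw4 _)

theorem card_one_iff_aux {α : Type} (s : Finset α) (P : α → Prop) [DecidablePred P] :
    (s.filter P).card = 1 ↔ ∃ b ∈ s, P b ∧ ∀ b' ∈ s, P b' → b' = b := by
  rw [Finset.card_eq_one]
  constructor
  · rintro ⟨b, hb⟩
    have h : ∀ x, x ∈ s.filter P ↔ x = b := by simp [hb]
    simp only [Finset.mem_filter] at h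
    exact ⟨b, ((h b).2 rfl).1, ((h b).2 rfl).2, fun b' h1 h2 => (h b').1 ⟨h1, h2⟩⟩
  · rintro ⟨b, h1, h2, h3⟩
    refine ⟨b, ?_⟩
    ext x
    simp only [Finset.mem_filter, Finset.mem_singleton]
    exact ⟨fun h => h3 x h.1 h.2, by rintro rfl; exact ⟨h1, h2⟩⟩

open Classical in
theorem aux_main (v : ℕ) (P : Type) [Fintype P]
    (α : Fin v → P) (β : Fin (v+1) → P) (hα : Function.Injective α) (hβ : Function.Injective β)
    (hαβ : ∀ i x, α i ≠ β x) (hex : ∀ z, (∃ i, z = α i) ∨ ∃ x, z = β x)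
    (p : Fin v → Fin (v+1) → Fin (v+1)) (w : Fin v → Fin (v+1) → ℤ)
    (hp1 : ∀ i x, p i (p i x) = x) (hp2 : ∀ i x, p i x ≠ x)
    (hp3 : ∀ x y, x ≠ y → ∃ i, p i x = y)
    (hw1 : ∀ i x, w i (p i x) = w i x) (hw2 : ∀ i x, w i x ≠ 0 ∧ |w i x| ≤ 2)
    (hw3 : ∀ x, ∑ i, w i x = 0) (hw4 : ∀ i, ∑ x, w i x = 0)
    (B : Finset (Finset (Fin v)))
    (hcard : ∀ b ∈ B, b.card = 3)
    (hpair : ∀ x y : Fin v, x ≠ y → (B.filter (fun b => x ∈ b ∧ y ∈ b)).card = 1)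
    (g : Finset (Fin v) → ℤ)
    (hgval : ∀ b ∈ B, g b ≠ 0 ∧ |g b| ≤ 2)
    (hgflow : ∀ x : Fin v, ∑ b ∈ B.filter (fun b => x ∈ b), g b = 0) :
    ∃ B' : Finset (Finset P),
      (∀ b ∈ B', b.card = 3) ∧
      (∀ x y : P, x ≠ y →
        (B'.filter (fun b => x ∈ b ∧ y ∈ b)).card = 1) ∧
      B.image (Finset.image α) ⊆ B' ∧
      ∃ g' : Finset P → ℤ,
        (∀ b ∈ B', g' b ≠ 0 ∧ |g' b| ≤ 2) ∧
        (∀ x : P, ∑ b ∈ B'.filter (fun b => x ∈ b), g' b = 0) ∧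
        (∀ b ∈ B, g' (b.image α) = g b) := by
  have hβα : ∀ i x, β x ≠ α i := fun i x h => hαβ i x h.symm
  have hpu : ∀ x i j, p i x = p j x → i = j := by
    intro x
    let f : Fin v → {y // y ≠ x} := fun i => ⟨p i x, hp2 i x⟩
    have hs : Function.Surjective f := by
      rintro ⟨y, hy⟩
      obtain ⟨i, hi⟩ := hp3 x y hy.symm
      exact ⟨i, Subtype.ext hi⟩
    have hb : Function.Bijective f :=
      (Fintype.bijective_iff_surjective_and_card f).2 ⟨hs, by simp [Fintype.card_subtype_compl]⟩
    intro i j h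
    exact hb.1 (Subtype.ext h)
  obtain ⟨blk, hblk⟩ : ∃ blk : Fin v → Fin (v+1) → Finset P,
    ∀ i x, blk i x = {α i, β x, β (p i x)} := ⟨_, fun _ _ => rfl⟩
  have mα : ∀ i x j, α j ∈ blk i x ↔ j = i := by
    intro i x j
    simp [hblk, hαβ, hα.eq_iff]
  have mβ : ∀ i x y, β y ∈ blk i x ↔ y = x ∨ y = p i x := by
    intro i x j
    simp [hblk, hβα, hβ.eq_iff]
  have iα : ∀ (b : Finset (Fin v)) j, α j ∈ b.image α ↔ j ∈ b := by
    intro b j; simp [hα.eq_iff]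
  have iβ : ∀ (b : Finset (Fin v)) x, β x ∉ b.image α := by
    intro b j; simp [hαβ]
  have bsym : ∀ i x, blk i (p i x) = blk i x := by
    intro i x
    rw [hblk, hblk, hp1, Finset.pair_comm]
  have binj : ∀ i x j y, blk i x = blk j y → i = j ∧ (x = y ∨ x = p j y) := by
    intro i x j y h
    refine ⟨?_, ?_⟩
    · rw [← mα j y, ← h, mα]
    · rw [← mβ, ← h, mβ]; simp
  have hne : ∀ (b : Finset (Fin v)) i x, b.image α ≠ blk i x := by
    intro b i x h
    apply iβ b x
    rw [h, mβ]; simp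
  let A := B.image (Finset.image α)
  let D := (Finset.univ : Finset (Fin v × Fin (v+1))).image (fun t => blk t.1 t.2)
  have mA : ∀ b, b ∈ A ↔ ∃ b0 ∈ B, b0.image α = b := by intro b; simp [A]
  have mD : ∀ b, b ∈ D ↔ ∃ i x, blk i x = b := by intro b; simp [D]
  let g' : Finset P → ℤ := fun b =>
    if h : ∃ t : Fin v × Fin (v+1), blk t.1 t.2 = b then w h.choose.1 h.choose.2
    else g (Finset.univ.filter (fun j => α j ∈ b))
  have gblk : ∀ i x, g' (blk i x) = w i x := by
    intro i x
    have h : ∃ t : Fin v × Fin (v+1), blk t.1 t.2 = blk i x := ⟨(i, x), rfl⟩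
    have e : g' (blk i x) = w h.choose.1 h.choose.2 := dif_pos h
    rw [e]
    obtain ⟨h1, h2⟩ := binj _ _ _ _ h.choose_spec
    rw [h1]
    rcases h2 with h2 | h2 <;> rw [h2]
    exact hw1 _ _
  have gimg : ∀ b : Finset (Fin v), g' (b.image α) = g b := by
    intro b
    have h : ¬ ∃ t : Fin v × Fin (v+1), blk t.1 t.2 = b.image α := by
      rintro ⟨t, ht⟩
      exact hne _ _ _ ht.symm
    have e : g' (b.image α) = g (Finset.univ.filter (fun j => α j ∈ b.image α)) := dif_neg h
    rw [e]
    congr 1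
    ext j
    simp only [Finset.mem_filter, Finset.mem_univ, true_and, iα]
  have hdisj : Disjoint A D := by
    rw [Finset.disjoint_left]
    intro b h1 h2
    obtain ⟨b0, _, rfl⟩ := (mA b).1 h1
    obtain ⟨i, x, h⟩ := (mD _).1 h2
    exact hne _ _ _ h.symm
  have mU : ∀ Q : Finset P → Prop, (∀ b ∈ A ∪ D, Q b) ↔
      (∀ b ∈ B, Q (b.image α)) ∧ ∀ i x, Q (blk i x) := by
    intro Q
    constructor
    · intro h
      exact ⟨fun b hb => h _ (Finset.mem_union_left _ ((mA _).2 ⟨b, hb, rfl⟩)),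
        fun i x => h _ (Finset.mem_union_right _ ((mD _).2 ⟨i, x, rfl⟩))⟩
    · rintro ⟨h1, h2⟩ b hb
      rcases Finset.mem_union.1 hb with hb | hb
      · obtain ⟨b0, h0, rfl⟩ := (mA b).1 hb
        exact h1 _ h0
      · obtain ⟨i, x, rfl⟩ := (mD b).1 hb
        exact h2 _ _
  have inA : ∀ b ∈ B, b.image α ∈ A ∪ D := fun b hb =>
    Finset.mem_union_left _ ((mA _).2 ⟨b, hb, rfl⟩)
  have inD : ∀ i x, blk i x ∈ A ∪ D := fun i x =>
    Finset.mem_union_right _ ((mD _).2 ⟨i, x, rfl⟩)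
  have cαβ : ∀ i x, ∃ b ∈ A ∪ D, (α i ∈ b ∧ β x ∈ b) ∧
      ∀ b' ∈ A ∪ D, (α i ∈ b' ∧ β x ∈ b') → b' = b := by
    intro i x
    refine ⟨blk i x, inD _ _, ⟨by simp [mα], by simp [mβ]⟩, ?_⟩
    rw [mU]
    refine ⟨fun b hb h => absurd h.2 (iβ _ _), ?_⟩
    intro j y h
    rw [mα, mβ] at h
    obtain ⟨rfl, rfl | rfl⟩ := h
    · rfl
    · exact (bsym _ _).symm
  refine ⟨A ∪ D, ?_, ?_, Finset.subset_union_left, g', ?_, ?_, fun b _ => gimg b⟩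
  · rw [mU]
    refine ⟨fun b hb => by rw [Finset.card_image_of_injective _ hα, hcard b hb], fun i x => ?_⟩
    rw [hblk, Finset.card_eq_three]
    exact ⟨_, _, _, hαβ _ _, hαβ _ _, fun h => hp2 i x (hβ h).symm, rfl⟩
  · intro x y hxy
    rw [card_one_iff_aux]
    rcases hex x with ⟨i, rfl⟩ | ⟨x, rfl⟩ <;> rcases hex y with ⟨j, rfl⟩ | ⟨y, rfl⟩
    · have hij : i ≠ j := fun h => hxy (by rw [h])
      have h := hpair i j hij
      obtain ⟨b, hb, hb1, hb2⟩ := (card_one_iff_aux _ _).1 (by convert h)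
      refine ⟨b.image α, inA b hb, by simpa only [iα] using hb1, ?_⟩
      rw [mU]
      refine ⟨fun b' h' h => ?_, fun l z h => ?_⟩
      · rw [iα, iα] at h
        rw [hb2 b' h' h]
      · rw [mα, mα] at h
        exact absurd (h.1.trans h.2.symm) hij
    · exact cαβ i y
    · obtain ⟨b, hb, h1, h2⟩ := cαβ j x
      exact ⟨b, hb, h1.symm, fun b' hb' h => h2 b' hb' h.symm⟩
    · have hne' : x ≠ y := fun h => hxy (by rw [h])
      obtain ⟨i, rfl⟩ := hp3 x y hne'
      refine ⟨blk i x, inD _ _, ⟨by simp [mβ], by simp [mβ]⟩, ?_⟩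
      rw [mU]
      refine ⟨fun b hb h => absurd h.1 (iβ _ _), ?_⟩
      intro j y h
      rw [mβ, mβ] at h
      obtain ⟨rfl | rfl, h2⟩ := h
      · rcases h2 with h2 | h2
        · exact absurd h2 (hp2 _ _)
        · rw [hpu _ _ _ h2]
      · rcases h2 with h2 | h2
        · have : p i (p j y) = p j (p j y) := by rw [h2, hp1]
          have := hpu _ _ _ this
          subst this
          rw [bsym]
        · exact absurd h2 (hp2 _ _)
  · rw [mU]
    exact ⟨fun b hb => by rw [gimg]; exact hgval b hb, fun i x => by rw [gblk]; exact hw2 i x⟩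
  · intro z
    rw [Finset.filter_union, Finset.sum_union (Finset.disjoint_filter_filter hdisj)]
    rcases hex z with ⟨i, rfl⟩ | ⟨x, rfl⟩
    · have e1 : ∑ b ∈ A.filter (fun b => α i ∈ b), g' b = 0 := by
        rw [← hgflow i]
        have : A.filter (fun b => α i ∈ b) =
            (B.filter (fun b => i ∈ b)).image (Finset.image α) := by
          simp only [A, Finset.filter_image, iα]
        rw [this, Finset.sum_image (fun a _ b _ h => Finset.image_injective hα h)]
        simp only [gimg]
      have e2 : 2 * ∑ b ∈ D.filter (fun b => α i ∈ b), g' b = ∑ x, w i x := by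
        have hm : ∀ x ∈ (Finset.univ : Finset (Fin (v+1))),
            blk i x ∈ D.filter (fun b => α i ∈ b) := by
          intro x _
          rw [Finset.mem_filter, mα, mD]
          exact ⟨⟨i, x, rfl⟩, rfl⟩
        rw [← Finset.sum_fiberwise_of_maps_to hm, Finset.mul_sum]
        refine Finset.sum_congr rfl fun b hb => ?_
        rw [Finset.mem_filter, mD] at hb
        obtain ⟨⟨j, x, rfl⟩, hb⟩ := hb
        rw [mα] at hb
        subst hb
        have : (Finset.univ.filter fun y => blk i y = blk i x) = {x, p i x} := by
          ext y
          simp only [Finset.mem_filter, Finset.mem_univ, true_and, Finset.mem_insert,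
            Finset.mem_singleton]
          constructor
          · intro h; exact (binj _ _ _ _ h).2
          · rintro (rfl | rfl)
            · rfl
            · exact bsym _ _
        rw [this, Finset.sum_pair (hp2 i x).symm, hw1, gblk]
        ring
      rw [hw4] at e2
      omega
    · have e1 : A.filter (fun b => β x ∈ b) = ∅ := by
        rw [Finset.filter_eq_empty_iff]
        intro b hb
        obtain ⟨b0, _, rfl⟩ := (mA b).1 hb
        exact iβ _ _
      have e2 : D.filter (fun b => β x ∈ b) = Finset.univ.image (fun i => blk i x) := by
        ext b
        rw [Finset.mem_filter, mD]
        simp only [Finset.mem_image, Finset.mem_univ, true_and]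
        constructor
        · rintro ⟨⟨i, y, rfl⟩, h⟩
          rw [mβ] at h
          rcases h with rfl | rfl
          · exact ⟨i, rfl⟩
          · exact ⟨i, bsym _ _⟩
        · rintro ⟨i, rfl⟩
          exact ⟨⟨i, x, rfl⟩, by simp [mβ]⟩
      rw [e1, e2, Finset.sum_empty, zero_add,
        Finset.sum_image (fun i _ j _ h => (binj _ _ _ _ h).1)]
      simp only [gblk]
      exact hw3 x


/-- if v ≡ 3 (mod 4), v > 3, every STS(v) with a zero-sum 3-flow embeds into an STS(2v+1) with a zero-sum 3-flow. -/
theorem stmt12 (v : ℕ) (hv : v % 4 = 3) (hv3 : 3 < v)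
    (B : Finset (Finset (Fin v)))
    (hcard : ∀ b ∈ B, b.card = 3)
    (hpair : ∀ x y : Fin v, x ≠ y → (B.filter (fun b => x ∈ b ∧ y ∈ b)).card = 1)
    (g : Finset (Fin v) → ℤ)
    (hgval : ∀ b ∈ B, g b ≠ 0 ∧ |g b| ≤ 2)
    (hgflow : ∀ x : Fin v, ∑ b ∈ B.filter (fun b => x ∈ b), g b = 0) :
    ∃ B' : Finset (Finset (Fin (2*v+1))),
      (∀ b ∈ B', b.card = 3) ∧
      (∀ x y : Fin (2*v+1), x ≠ y →
        (B'.filter (fun b => x ∈ b ∧ y ∈ b)).card = 1) ∧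
      B.image (Finset.image (Fin.castLE (by omega : v ≤ 2*v+1))) ⊆ B' ∧
      ∃ g' : Finset (Fin (2*v+1)) → ℤ,
        (∀ b ∈ B', g' b ≠ 0 ∧ |g' b| ≤ 2) ∧
        (∀ x : Fin (2*v+1), ∑ b ∈ B'.filter (fun b => x ∈ b), g' b = 0) ∧
        (∀ b ∈ B, g' (b.image (Fin.castLE (by omega : v ≤ 2*v+1))) = g b) := by
  obtain ⟨p, w, h1, h2, h3, h4, h5, h6, h7⟩ := aux_fact v hv hv3
  have := aux_main v (Fin (2*v+1)) (Fin.castLE (by omega : v ≤ 2*v+1))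
    (fun x => ⟨v + x.1, by omega⟩) (Fin.castLE_injective _)
    (fun a b h => by simp only [Fin.mk.injEq] at h; exact Fin.ext (by omega))
    (fun i x h => by
      have := congrArg Fin.val h
      simp only [Fin.val_castLE] at this
      omega)
    (fun z => by
      by_cases h : z.1 < v
      · exact Or.inl ⟨⟨z.1, h⟩, Fin.ext rfl⟩
      · exact Or.inr ⟨⟨z.1 - v, by omega⟩, Fin.ext (by simp only; omega)⟩)
    p w h1 h2 h3 h4 h5 h6 h7 B hcard (fun x y h => by convert hpair x y h) g hgval
    (fun x => by convert hgflow x)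
  convert this
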